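/- For d ≥ 2, the two-fold convolution of the surface measure σ of 𝕊^{d-1} with itself is the absolutely continuous measure with density (σ∗σ)(x) = 2^{3-d} σ_{d-2}(𝕊^{d-2}) · (4 − |x|²)^{(d-3)/2}/|x| for 0 < |x| < 2, and zero for |x| > 2. -/

import Mathlib

open MeasureTheory Metric Real
open scoped ENNReal

section Polar

variable {E : Type*} [NormedAddCommGroup E] [NormedSpace ℝ E] [FiniteDimensional ℝ E]
  [Nontrivial E] [MeasurableSpace E] [BorelSpace E]

/-- Integration in polar coordinates. -/
theorem lintegral_eq_lintegral_toSphere (μ : Measure E) [μ.IsAddHaarMeasure]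
    {f : E → ℝ≥0∞} (hf : Measurable f) :
    ∫⁻ x, f x ∂μ = ∫⁻ ω : sphere (0 : E) 1, (∫⁻ r in Set.Ioi (0 : ℝ),
      ENNReal.ofReal (r ^ (Module.finrank ℝ E - 1)) * f (r • (ω : E))) ∂μ.toSphere := by
  calc
    ∫⁻ x, f x ∂μ = ∫⁻ x : ({0}ᶜ : Set E), f x ∂(μ.comap (↑)) := by
      rw [lintegral_subtype_comap (measurableSet_singleton _).compl,
        restrict_compl_singleton]
    _ = ∫⁻ p : sphere (0 : E) 1 × Set.Ioi (0 : ℝ), f ((p.2 : ℝ) • (p.1 : E))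
          ∂μ.toSphere.prod (.volumeIoiPow (Module.finrank ℝ E - 1)) := by
      rw [← μ.measurePreserving_homeomorphUnitSphereProd.lintegral_comp_emb
        (Homeomorph.measurableEmbedding _)]
      refine lintegral_congr fun x => ?_
      have hx : ‖(x : E)‖ ≠ 0 := norm_ne_zero_iff.2 x.2
      simp [smul_smul, hx]
    _ = _ := by
      rw [lintegral_prod _ (by fun_prop)]
      refine lintegral_congr fun ω => ?_
      rw [Measure.volumeIoiPow, lintegral_withDensity_eq_lintegral_mul _ (by fun_prop)
        (by fun_prop), ← lintegral_subtype_comap measurableSet_Ioi]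
      rfl

theorem lintegral_fun_norm_eq_toSphere (μ : Measure E) [μ.IsAddHaarMeasure]
    {f : ℝ → ℝ≥0∞} (hf : Measurable f) :
    ∫⁻ x, f ‖x‖ ∂μ = μ.toSphere Set.univ * ∫⁻ r in Set.Ioi (0 : ℝ),
      ENNReal.ofReal (r ^ (Module.finrank ℝ E - 1)) * f r := by
  rw [lintegral_eq_lintegral_toSphere μ (by fun_prop), mul_comm, ← lintegral_const]
  refine lintegral_congr fun ω => setLIntegral_congr_fun measurableSet_Ioi fun r hr => ?_
  have : ‖r • (ω : E)‖ = r := by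
    rw [norm_smul, norm_eq_of_mem_sphere, mul_one, Real.norm_of_nonneg (le_of_lt hr)]
  simp only [this]

end Polar

section Invariant

theorem exists_linearIsometryEquiv_apply_eq {E : Type*} [NormedAddCommGroup E]
    [InnerProductSpace ℝ E] {v w : E} (h : ‖v‖ = ‖w‖) : ∃ L : E ≃ₗᵢ[ℝ] E, L v = w :=
  ⟨_, Submodule.reflection_sub h⟩

variable {E : Type*} [NormedAddCommGroup E] [InnerProductSpace ℝ E] [FiniteDimensional ℝ E]
  [MeasurableSpace E] [BorelSpace E]

open scoped Pointwise in
theorem map_linearIsometryEquiv_map_coe_toSphere (L : E ≃ₗᵢ[ℝ] E) :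
    (((volume : Measure E).toSphere.map Subtype.val).map L) =
      (volume : Measure E).toSphere.map Subtype.val := by
  ext s hs
  have hL : Measurable L := L.continuous.measurable
  have hLs : MeasurableSet (L ⁻¹' s) := hL hs
  rw [Measure.map_apply hL hs, Measure.map_apply measurable_subtype_coe hs,
    Measure.map_apply measurable_subtype_coe hLs,
    Measure.toSphere_apply' _ (measurable_subtype_coe hs),
    Measure.toSphere_apply' _ (measurable_subtype_coe hLs),
    Subtype.image_preimage_coe, Subtype.image_preimage_coe,
    ← L.measurePreserving.measure_preimage_emb L.toHomeomorph.measurableEmbedding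
      (Set.Ioo (0 : ℝ) 1 • (sphere 0 1 ∩ s))]
  congr 2
  ext x
  simp only [Set.mem_preimage, Set.mem_smul]
  constructor
  · rintro ⟨r, hr, y, ⟨hy, hys⟩, rfl⟩
    exact ⟨r, hr, L y, ⟨by simpa using hy, hys⟩, by simp⟩
  · rintro ⟨r, hr, y, ⟨hy, hys⟩, hxy⟩
    exact ⟨r, hr, L.symm y, ⟨by simpa using hy, by simpa using hys⟩, by simp [← map_smul, hxy]⟩

theorem charFun_eq_of_norm_eq {μ : Measure E} (hμ : ∀ L : E ≃ₗᵢ[ℝ] E, μ.map L = μ)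
    {v w : E} (h : ‖v‖ = ‖w‖) : charFun μ v = charFun μ w := by
  obtain ⟨L, rfl⟩ := exists_linearIsometryEquiv_apply_eq h
  have hL : Measurable L := L.continuous.measurable
  conv_rhs => rw [← hμ L]
  rw [charFun_apply, charFun_apply, integral_map hL.aemeasurable (by fun_prop)]
  simp

/-- A finite measure invariant under all linear isometries is determined by the distribution of
the norm. -/
theorem MeasureTheory.Measure.ext_of_map_norm [Nontrivial E] {μ ν : Measure E} [IsFiniteMeasure μ]
    [IsFiniteMeasure ν]
    (hμ : ∀ L : E ≃ₗᵢ[ℝ] E, μ.map L = μ) (hν : ∀ L : E ≃ₗᵢ[ℝ] E, ν.map L = ν)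
    (h : μ.map (fun x => ‖x‖) = ν.map (fun x => ‖x‖)) : μ = ν := by
  set ρ : Measure E := (volume : Measure E).toSphere.map Subtype.val with hρ
  have hρL : ∀ L : E ≃ₗᵢ[ℝ] E, ρ.map L = ρ := map_linearIsometryEquiv_map_coe_toSphere
  obtain ⟨e, he⟩ := exists_norm_eq E (zero_le_one (α := ℝ))
  have hρ0 : ρ.real Set.univ ≠ 0 := by
    rw [hρ, map_measureReal_apply measurable_subtype_coe .univ, Set.preimage_univ]
    exact (measureReal_ne_zero_iff (measure_ne_top _ _)).2
      (Measure.measure_univ_ne_zero.2 (Measure.toSphere_ne_zero _))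
  have key : ∀ (κ : Measure E) [IsFiniteMeasure κ], (∀ L : E ≃ₗᵢ[ℝ] E, κ.map L = κ) → ∀ ξ : E,
      ρ.real Set.univ * charFun κ ξ =
        ∫ r, charFun ρ ((‖ξ‖ * r) • e) ∂(κ.map (fun x => ‖x‖)) := by
    intro κ _ hκ ξ
    have hmeas : Measurable fun r : ℝ => charFun ρ ((‖ξ‖ * r) • e) :=
      measurable_charFun.comp (by fun_prop)
    rw [integral_map (by fun_prop) hmeas.aestronglyMeasurable]
    calc
      (ρ.real Set.univ : ℂ) * charFun κ ξ = ∫ ω, charFun κ (‖ξ‖ • ω) ∂ρ := by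
        rw [integral_congr_ae (g := fun _ => charFun κ ξ)]
        · simp
        · rw [hρ]
          refine (ae_map_iff (by fun_prop) (measurableSet_eq_fun
            (measurable_charFun.comp (by fun_prop)) (by fun_prop))).2 (.of_forall fun ω => ?_)
          apply charFun_eq_of_norm_eq hκ
          simp [norm_smul]
      _ = ∫ ω, ∫ x, Complex.exp (inner ℝ x (‖ξ‖ • ω) * Complex.I) ∂κ ∂ρ := rfl
      _ = ∫ x, ∫ ω, Complex.exp (inner ℝ x (‖ξ‖ • ω) * Complex.I) ∂ρ ∂κ := by
        apply integral_integral_swap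
        refine Integrable.mono' (g := fun _ => 1) (integrable_const _) ?_ ?_
        · apply Continuous.aestronglyMeasurable
          fun_prop
        · refine .of_forall fun p => ?_
          exact (Complex.norm_exp_ofReal_mul_I _).le
      _ = ∫ x, charFun ρ (‖ξ‖ • x) ∂κ := by
        refine integral_congr_ae (.of_forall fun x => ?_)
        refine integral_congr_ae (.of_forall fun ω => ?_)
        dsimp only
        rw [inner_smul_right, inner_smul_right, real_inner_comm]
      _ = _ := by
        refine integral_congr_ae (.of_forall fun x => ?_)
        apply charFun_eq_of_norm_eq hρL
        simp [norm_smul, he]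
  refine Measure.ext_of_charFun (funext fun ξ => ?_)
  have := key μ hμ ξ
  rw [h, ← key ν hν ξ] at this
  exact mul_left_cancel₀ (by exact_mod_cast hρ0) this

end Invariant

section Slice

theorem lintegral_apply_zero_norm (n : ℕ) {f : ℝ → ℝ → ℝ≥0∞}
    (hf : Measurable (Function.uncurry f)) :
    ∫⁻ x : EuclideanSpace ℝ (Fin (n + 1)), f (x 0) ‖x‖ =
      ∫⁻ t : ℝ, ∫⁻ y : EuclideanSpace ℝ (Fin n), f t √(t ^ 2 + ‖y‖ ^ 2) := by
  have hmp := ((MeasurePreserving.id (volume : Measure ℝ)).prod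
    (PiLp.volume_preserving_toLp (Fin n))).comp
    ((volume_preserving_piFinSuccAbove (fun _ : Fin (n + 1) => ℝ) 0).comp
      (PiLp.volume_preserving_ofLp (Fin (n + 1))))
  have hg : Measurable fun p : ℝ × EuclideanSpace ℝ (Fin n) => f p.1 √(p.1 ^ 2 + ‖p.2‖ ^ 2) :=
    hf.comp (f := fun p : ℝ × EuclideanSpace ℝ (Fin n) => (p.1, √(p.1 ^ 2 + ‖p.2‖ ^ 2)))
      (by fun_prop)
  rw [← lintegral_prod _ hg.aemeasurable, ← hmp.lintegral_comp hg]
  refine lintegral_congr fun x => ?_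
  have : ‖x‖ = √(x 0 ^ 2 + ∑ j : Fin n, x j.succ ^ 2) := by
    rw [EuclideanSpace.norm_eq, Fin.sum_univ_succ]
    simp
  rw [this]
  simp [EuclideanSpace.norm_sq_eq, MeasurableEquiv.piFinSuccAbove, Fin.tail]

theorem lintegral_pow_Ioo_ne_zero (n : ℕ) :
    ∫⁻ r in Set.Ioo (0 : ℝ) 1, ENNReal.ofReal (r ^ n) ≠ 0 := by
  refine ((setLIntegral_pos_iff (by fun_prop)).2 ?_).ne'
  have : Set.Ioo (0 : ℝ) 1 ⊆ (Function.support fun r : ℝ => ENNReal.ofReal (r ^ n)) ∩ Set.Ioo 0 1 :=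
    fun r hr => ⟨(ENNReal.ofReal_pos.2 (pow_pos hr.1 n)).ne', hr⟩
  exact lt_of_lt_of_le (by simp) (measure_mono this)

theorem lintegral_pow_Ioo_ne_top (n : ℕ) :
    ∫⁻ r in Set.Ioo (0 : ℝ) 1, ENNReal.ofReal (r ^ n) ≠ ⊤ := by
  refine ne_top_of_le_ne_top ENNReal.one_ne_top ?_
  calc ∫⁻ r in Set.Ioo (0 : ℝ) 1, ENNReal.ofReal (r ^ n)
      ≤ ∫⁻ _ in Set.Ioo (0 : ℝ) 1, 1 :=
        setLIntegral_mono' measurableSet_Ioo fun r hr =>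
          ENNReal.ofReal_le_one.2 (pow_le_one₀ hr.1.le hr.2.le)
    _ = 1 := by simp

/-- The distribution of the first coordinate under the surface measure of the unit sphere. -/
theorem lintegral_toSphere_apply_zero (n : ℕ) [NeZero n] {g : ℝ → ℝ≥0∞} (hg : Measurable g) :
    ∫⁻ ω : sphere (0 : EuclideanSpace ℝ (Fin (n + 1))) 1,
        g ((ω : EuclideanSpace ℝ (Fin (n + 1))) 0) ∂(volume : Measure _).toSphere =
      (volume : Measure (EuclideanSpace ℝ (Fin n))).toSphere Set.univ *
        ∫⁻ θ in Set.Ioo 0 π, ENNReal.ofReal (sin θ ^ (n - 1)) * g (cos θ) := by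
  have hK0 := lintegral_pow_Ioo_ne_zero n
  have hKtop := lintegral_pow_Ioo_ne_top n
  set K := ∫⁻ r in Set.Ioo (0 : ℝ) 1, ENNReal.ofReal (r ^ n) with hK
  have hn : 0 < n := Nat.pos_of_ne_zero (NeZero.ne n)
  set f : ℝ → ℝ → ℝ≥0∞ := fun t r => (Set.Iio (1 : ℝ)).indicator 1 r * g (t / r) with hfdef
  have hind : Measurable ((Set.Iio (1 : ℝ)).indicator (1 : ℝ → ℝ≥0∞)) :=
    measurable_one.indicator measurableSet_Iio
  have hf : Measurable (Function.uncurry f) := by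
    unfold Function.uncurry
    fun_prop
  have hKind : ∀ c : ℝ≥0∞, ∫⁻ r in Set.Ioi (0 : ℝ), ENNReal.ofReal (r ^ n) *
      ((Set.Iio (1 : ℝ)).indicator 1 r * c) = K * c := by
    intro c
    simp_rw [← mul_assoc]
    rw [lintegral_mul_const _ (by fun_prop), hK, ← Set.Ioi_inter_Iio, Set.inter_comm,
      ← Measure.restrict_restrict measurableSet_Iio, ← lintegral_indicator measurableSet_Iio]
    congr 2 with r
    by_cases hr : r < 1 <;> simp [hr]
  have h1 : ∫⁻ x : EuclideanSpace ℝ (Fin (n + 1)), f (x 0) ‖x‖ =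
      K * ∫⁻ ω : sphere (0 : EuclideanSpace ℝ (Fin (n + 1))) 1,
        g ((ω : EuclideanSpace ℝ (Fin (n + 1))) 0) ∂(volume : Measure _).toSphere := by
    have hfx : Measurable fun x : EuclideanSpace ℝ (Fin (n + 1)) => f (x 0) ‖x‖ :=
      hf.comp (f := fun x : EuclideanSpace ℝ (Fin (n + 1)) => (x 0, ‖x‖)) (by fun_prop)
    rw [lintegral_eq_lintegral_toSphere _ hfx, ← lintegral_const_mul _ (by fun_prop)]
    refine lintegral_congr fun ω => ?_
    rw [← hKind]
    refine setLIntegral_congr_fun measurableSet_Ioi fun r hr => ?_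
    have hr : 0 < r := hr
    have : ‖r • (ω : EuclideanSpace ℝ (Fin (n + 1)))‖ = r := by
      rw [norm_smul, norm_eq_of_mem_sphere, mul_one, Real.norm_of_nonneg hr.le]
    simp [this, hfdef, hr.ne']
  have h2 : ∫⁻ x : EuclideanSpace ℝ (Fin (n + 1)), f (x 0) ‖x‖ =
      K * ((volume : Measure (EuclideanSpace ℝ (Fin n))).toSphere Set.univ *
        ∫⁻ θ in Set.Ioo 0 π, ENNReal.ofReal (sin θ ^ (n - 1)) * g (cos θ)) := by
    set h : ℝ × ℝ → ℝ≥0∞ := fun p => (Set.Ioi (0 : ℝ)).indicator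
      (fun s => ENNReal.ofReal (s ^ (n - 1)) * f p.1 √(p.1 ^ 2 + s ^ 2)) p.2 with hh
    have hmeas : Measurable fun p : ℝ × ℝ =>
        ENNReal.ofReal (p.2 ^ (n - 1)) * f p.1 √(p.1 ^ 2 + p.2 ^ 2) :=
      Measurable.mul (by fun_prop)
        (hf.comp (f := fun p : ℝ × ℝ => (p.1, √(p.1 ^ 2 + p.2 ^ 2))) (by fun_prop))
    have hhm : Measurable h := hmeas.indicator (s := {p : ℝ × ℝ | 0 < p.2})
      (measurableSet_lt (by fun_prop) (by fun_prop))
    have h3 : ∫⁻ p, h p = K * ∫⁻ θ in Set.Ioo 0 π, ENNReal.ofReal (sin θ ^ (n - 1)) * g (cos θ) := by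
      rw [← lintegral_comp_polarCoord_symm, polarCoord_target, Measure.volume_eq_prod,
        ← Measure.prod_restrict, lintegral_prod_symm]
      · have hset : Set.Ioo 0 π = Set.Ioi 0 ∩ Set.Ioo (-π) π := by
          ext θ
          simp only [Set.mem_Ioo, Set.mem_inter_iff, Set.mem_Ioi]
          constructor
          · exact fun hθ => ⟨hθ.1, by linarith [pi_pos], hθ.2⟩
          · exact fun hθ => ⟨hθ.1, hθ.2.2⟩
        rw [← lintegral_const_mul _ (by fun_prop), hset,
          ← Measure.restrict_restrict measurableSet_Ioi, ← lintegral_indicator measurableSet_Ioi]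
        refine setLIntegral_congr_fun measurableSet_Ioo fun θ hθ => ?_
        by_cases hθ0 : 0 < θ
        · have hsin : 0 < sin θ := sin_pos_of_pos_of_lt_pi hθ0 hθ.2
          rw [Set.indicator_of_mem (Set.mem_Ioi.2 hθ0), ← hKind]
          refine setLIntegral_congr_fun measurableSet_Ioi fun r hr => ?_
          have hr : 0 < r := hr
          have hsq : √((r * cos θ) ^ 2 + (r * sin θ) ^ 2) = r := by
            rw [show (r * cos θ) ^ 2 + (r * sin θ) ^ 2 = r ^ 2 by
              linear_combination r ^ 2 * sin_sq_add_cos_sq θ, sqrt_sq hr.le]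
          have hpow : ENNReal.ofReal (r ^ n) * ENNReal.ofReal (sin θ ^ (n - 1)) =
              ENNReal.ofReal r * ENNReal.ofReal ((r * sin θ) ^ (n - 1)) := by
            rw [← ENNReal.ofReal_mul (by positivity), ← ENNReal.ofReal_mul hr.le, mul_pow,
              ← mul_assoc, mul_pow_sub_one hn.ne']
          simp only [polarCoord_symm_apply, hh, smul_eq_mul]
          rw [Set.indicator_of_mem (Set.mem_Ioi.2 (mul_pos hr hsin)), hsq, hfdef]
          dsimp only
          rw [mul_div_cancel_left₀ _ hr.ne', ← mul_assoc, ← hpow]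
          ring
        · have hsin : sin θ ≤ 0 := sin_nonpos_of_nonpos_of_neg_pi_le (not_lt.1 hθ0) hθ.1.le
          rw [Set.indicator_of_notMem (by simpa using hθ0)]
          refine (setLIntegral_congr_fun measurableSet_Ioi (g := 0) fun r hr => ?_).trans (by simp)
          have hr : 0 < r := hr
          simp only [polarCoord_symm_apply, hh, smul_eq_mul]
          rw [Set.indicator_of_notMem]
          · simp
          · exact not_lt.2 (mul_nonpos_of_nonneg_of_nonpos hr.le hsin)
      · have : Measurable fun p : ℝ × ℝ => polarCoord.symm p := by
          simp only [polarCoord_symm_apply]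
          fun_prop
        have hcomp : Measurable fun p : ℝ × ℝ => h (polarCoord.symm p) := hhm.comp this
        fun_prop
    rw [lintegral_apply_zero_norm n hf, mul_left_comm, ← h3, Measure.volume_eq_prod,
      lintegral_prod _ hhm.aemeasurable, ← lintegral_const_mul _ hhm.lintegral_prod_right']
    refine lintegral_congr fun t => ?_
    have hft : Measurable fun s => f t √(t ^ 2 + s ^ 2) :=
      hf.comp (f := fun s : ℝ => (t, √(t ^ 2 + s ^ 2))) (by fun_prop)
    rw [lintegral_fun_norm_eq_toSphere (f := fun s => f t √(t ^ 2 + s ^ 2)) _ hft,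
      finrank_euclideanSpace_fin, ← lintegral_indicator measurableSet_Ioi]
  rw [h1] at h2
  exact (ENNReal.mul_right_inj hK0 hKtop).1 h2

end Slice

section Chord

theorem toSphere_univ_euclideanSpace (n : ℕ) [NeZero n] :
    (volume : Measure (EuclideanSpace ℝ (Fin n))).toSphere Set.univ =
      ENNReal.ofReal (2 * π ^ ((n : ℝ) / 2) / Gamma ((n : ℝ) / 2)) := by
  have hn : (0 : ℝ) < n := Nat.cast_pos.2 (Nat.pos_of_ne_zero (NeZero.ne n))
  rw [Measure.toSphere_apply_univ, EuclideanSpace.volume_ball, finrank_euclideanSpace_fin,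
    ← ENNReal.ofReal_natCast, ENNReal.ofReal_one, one_pow, one_mul,
    ← ENNReal.ofReal_mul hn.le, Fintype.card_fin, Gamma_add_one (by positivity),
    sqrt_eq_rpow, ← rpow_mul_natCast pi_pos.le]
  congr 1
  have := (Gamma_pos_of_pos (half_pos hn)).ne'
  rw [show 1 / 2 * (n : ℝ) = n / 2 by ring]
  field_simp

theorem image_two_mul_cos_half_Ioo :
    (fun θ : ℝ => 2 * cos (θ / 2)) '' Set.Ioo 0 π = Set.Ioo 0 2 := by
  ext r
  constructor
  · rintro ⟨θ, hθ, rfl⟩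
    have h1 : 0 < cos (θ / 2) := cos_pos_of_mem_Ioo ⟨by linarith [hθ.1, pi_pos], by linarith [hθ.2]⟩
    have h2 : cos (θ / 2) < cos 0 :=
      cos_lt_cos_of_nonneg_of_le_pi le_rfl (by linarith [hθ.2, pi_pos]) (by linarith [hθ.1])
    rw [cos_zero] at h2
    exact ⟨by positivity, by dsimp only; linarith⟩
  · rintro ⟨h0, h2⟩
    refine ⟨2 * arccos (r / 2), ⟨?_, ?_⟩, ?_⟩
    · have := arccos_pos.2 (show r / 2 < 1 by linarith)
      positivity
    · have := arccos_lt_pi_div_two.2 (show 0 < r / 2 by linarith)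
      linarith
    · dsimp only
      rw [mul_div_cancel_left₀ _ two_ne_zero, cos_arccos (by linarith) (by linarith)]
      ring

theorem lintegral_sin_pow_mul_comp_sqrt (n : ℕ) [NeZero n] (g : ℝ → ℝ≥0∞) :
    ∫⁻ θ in Set.Ioo 0 π, ENNReal.ofReal (sin θ ^ (n - 1)) * g √(2 + 2 * cos θ) =
      ∫⁻ r in Set.Ioo 0 2, ENNReal.ofReal
        (2 ^ ((2 : ℝ) - n) * r ^ (n - 1) * (4 - r ^ 2) ^ (((n : ℝ) - 2) / 2)) * g r := by
  have hderiv : ∀ θ ∈ Set.Ioo 0 π, HasDerivWithinAt (fun θ : ℝ => 2 * cos (θ / 2))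
      (-sin (θ / 2)) (Set.Ioo 0 π) θ := by
    intro θ _
    have := (((hasDerivAt_id θ).div_const 2).cos).const_mul 2
    refine (this.congr_deriv ?_).hasDerivWithinAt
    simp
    ring
  have hinj : Set.InjOn (fun θ : ℝ => 2 * cos (θ / 2)) (Set.Ioo 0 π) := by
    intro a ha b hb hab
    have := injOn_cos ⟨by linarith [ha.1], by linarith [ha.2, pi_pos]⟩
      ⟨by linarith [hb.1], by linarith [hb.2, pi_pos]⟩ (mul_left_cancel₀ two_ne_zero hab)
    linarith
  rw [← image_two_mul_cos_half_Ioo,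
    lintegral_image_eq_lintegral_abs_deriv_mul measurableSet_Ioo hderiv hinj]
  refine setLIntegral_congr_fun measurableSet_Ioo fun θ hθ => ?_
  have hc : 0 < cos (θ / 2) := cos_pos_of_mem_Ioo ⟨by linarith [hθ.1, pi_pos], by linarith [hθ.2]⟩
  have hs : 0 < sin (θ / 2) :=
    sin_pos_of_pos_of_lt_pi (by linarith [hθ.1]) (by linarith [hθ.2, pi_pos])
  have hsin : sin θ = 2 * sin (θ / 2) * cos (θ / 2) := by rw [← sin_two_mul]; ring_nf
  have hcos : cos θ = 2 * cos (θ / 2) ^ 2 - 1 := by rw [← cos_two_mul]; ring_nf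
  have hsqrt : √(2 + 2 * cos θ) = 2 * cos (θ / 2) := by
    rw [hcos, show 2 + 2 * (2 * cos (θ / 2) ^ 2 - 1) = (2 * cos (θ / 2)) ^ 2 by ring,
      sqrt_sq (by positivity)]
  have h4 : (4 - (2 * cos (θ / 2)) ^ 2) ^ (((n : ℝ) - 2) / 2) = (2 * sin (θ / 2)) ^ ((n : ℝ) - 2) := by
    rw [show 4 - (2 * cos (θ / 2)) ^ 2 = (2 * sin (θ / 2)) ^ 2 by
      linear_combination -4 * sin_sq_add_cos_sq (θ / 2), ← rpow_natCast, ← rpow_mul (by positivity)]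
    congr 1
    push_cast
    ring
  rw [hsqrt, abs_neg, abs_of_pos hs, ← mul_assoc, ← ENNReal.ofReal_mul hs.le, h4, hsin]
  congr 2
  obtain ⟨m, rfl⟩ := Nat.exists_eq_succ_of_ne_zero (NeZero.ne n)
  rw [show (2 : ℝ) - ((m.succ : ℕ) : ℝ) = 1 - m by push_cast; ring,
    show ((m.succ : ℕ) : ℝ) - 2 = m - 1 by push_cast; ring, Nat.succ_sub_one,
    rpow_sub two_pos, rpow_sub (by positivity), rpow_one, rpow_one, rpow_natCast, rpow_natCast]
  simp only [mul_pow]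
  field_simp

theorem lintegral_norm_add_toSphere (n : ℕ) [NeZero n] {g : ℝ → ℝ≥0∞} (hg : Measurable g)
    {u : EuclideanSpace ℝ (Fin (n + 1))} (hu : ‖u‖ = 1) :
    ∫⁻ ω : sphere (0 : EuclideanSpace ℝ (Fin (n + 1))) 1,
        g ‖u + ω‖ ∂(volume : Measure _).toSphere =
      (volume : Measure (EuclideanSpace ℝ (Fin n))).toSphere Set.univ *
        ∫⁻ r in Set.Ioo 0 2, ENNReal.ofReal
          (2 ^ ((2 : ℝ) - n) * r ^ (n - 1) * (4 - r ^ 2) ^ (((n : ℝ) - 2) / 2)) * g r := by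
  set e : EuclideanSpace ℝ (Fin (n + 1)) := EuclideanSpace.single 0 1 with he
  have hen : ‖e‖ = 1 := by simp [he]
  obtain ⟨L, hL⟩ := exists_linearIsometryEquiv_apply_eq (hen.trans hu.symm)
  rw [← lintegral_sin_pow_mul_comp_sqrt,
    ← lintegral_toSphere_apply_zero n (g := fun t => g √(2 + 2 * t)) (by fun_prop)]
  have hmL : Measurable L := L.continuous.measurable
  calc
    _ = ∫⁻ x, g ‖u + x‖ ∂((volume : Measure _).toSphere.map Subtype.val) := by
      rw [lintegral_map (by fun_prop) (by fun_prop)]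
    _ = ∫⁻ x, g ‖e + x‖ ∂((volume : Measure _).toSphere.map Subtype.val) := by
      rw [← map_linearIsometryEquiv_map_coe_toSphere L, lintegral_map (by fun_prop) hmL,
        map_linearIsometryEquiv_map_coe_toSphere L]
      refine lintegral_congr fun x => ?_
      rw [← hL, ← map_add, L.norm_map]
    _ = _ := by
      rw [lintegral_map (by fun_prop) (by fun_prop)]
      refine lintegral_congr fun ω => ?_
      have : ‖e + (ω : EuclideanSpace ℝ (Fin (n + 1)))‖ ^ 2 =
          2 + 2 * (ω : EuclideanSpace ℝ (Fin (n + 1))) 0 := by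
        rw [norm_add_sq_real, hen, norm_eq_of_mem_sphere, he, EuclideanSpace.inner_single_left]
        simp
        ring
      rw [← this, sqrt_sq (norm_nonneg _)]

end Chord

section Convolution

/-- The radial profile of the density of the self-convolution of the surface measure of the unit
sphere of `ℝ ^ d`. -/
noncomputable def sphereSelfConvProfile (d : ℕ) (r : ℝ) : ℝ :=
  if 0 < r ∧ r < 2 then
    2 ^ ((3 : ℝ) - d) * (2 * π ^ (((d : ℝ) - 1) / 2) / Gamma (((d : ℝ) - 1) / 2))
      * (4 - r ^ 2) ^ (((d : ℝ) - 3) / 2) / r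
  else 0

theorem measurable_sphereSelfConvProfile (d : ℕ) : Measurable (sphereSelfConvProfile d) :=
  Measurable.ite (measurableSet_Ioo (a := (0 : ℝ)) (b := 2)) (by fun_prop) measurable_const

theorem sphereSelfConvProfile_nonneg {d : ℕ} (hd : 2 ≤ d) (r : ℝ) :
    0 ≤ sphereSelfConvProfile d r := by
  have hd' : (2 : ℝ) ≤ d := by exact_mod_cast hd
  unfold sphereSelfConvProfile
  split_ifs with h
  · have h1 : 0 ≤ 4 - r ^ 2 := by nlinarith [h.1, h.2]
    have h2 : 0 < Gamma (((d : ℝ) - 1) / 2) := Gamma_pos_of_pos (by linarith)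
    have h3 := h.1
    positivity
  · exact le_rfl

/-- The distribution of the sum of two independent points of the unit sphere, each distributed
according to the surface measure. -/
noncomputable def sphereSelfConv (d : ℕ) : Measure (EuclideanSpace ℝ (Fin d)) :=
  (volume : Measure (EuclideanSpace ℝ (Fin d))).toSphere.map Subtype.val ∗
    (volume : Measure (EuclideanSpace ℝ (Fin d))).toSphere.map Subtype.val

theorem lintegral_norm_sphereSelfConv (n : ℕ) [NeZero n] {g : ℝ → ℝ≥0∞} (hg : Measurable g) :
    ∫⁻ x, g ‖x‖ ∂sphereSelfConv (n + 1) = ∫⁻ x : EuclideanSpace ℝ (Fin (n + 1)),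
      ENNReal.ofReal (sphereSelfConvProfile (n + 1) ‖x‖) * g ‖x‖ := by
  have hprof := measurable_sphereSelfConvProfile (n + 1)
  have hn : (0 : ℝ) < n := Nat.cast_pos.2 (Nat.pos_of_ne_zero (NeZero.ne n))
  rw [lintegral_fun_norm_eq_toSphere
    (f := fun r => ENNReal.ofReal (sphereSelfConvProfile (n + 1) r) * g r) _ (by fun_prop),
    sphereSelfConv, Measure.lintegral_conv (by fun_prop), lintegral_map
      (Measurable.lintegral_prod_right' (f := fun p : EuclideanSpace ℝ (Fin (n + 1)) ×
        EuclideanSpace ℝ (Fin (n + 1)) => g ‖p.1 + p.2‖) (by fun_prop)) (by fun_prop),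
    mul_comm, ← lintegral_const]
  refine lintegral_congr fun ω => ?_
  rw [lintegral_map (by fun_prop) (by fun_prop),
    lintegral_norm_add_toSphere n hg (norm_eq_of_mem_sphere ω), toSphere_univ_euclideanSpace,
    ← lintegral_const_mul _ (by fun_prop), ← Set.Ioi_inter_Iio, Set.inter_comm,
    ← Measure.restrict_restrict measurableSet_Iio, ← lintegral_indicator measurableSet_Iio]
  refine setLIntegral_congr_fun measurableSet_Ioi fun r hr => ?_
  have hr : 0 < r := hr
  by_cases hr2 : r < 2
  · rw [Set.indicator_of_mem (Set.mem_Iio.2 hr2), ← mul_assoc, ← mul_assoc,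
      ← ENNReal.ofReal_mul, ← ENNReal.ofReal_mul (by positivity), sphereSelfConvProfile,
      if_pos ⟨hr, hr2⟩, finrank_euclideanSpace_fin]
    · congr 2
      obtain ⟨m, rfl⟩ := Nat.exists_eq_succ_of_ne_zero (NeZero.ne n)
      push_cast
      rw [show (3 : ℝ) - (m + 1 + 1) = 2 - (m + 1) by ring,
        show (m : ℝ) + 1 + 1 - 3 = m + 1 - 2 by ring, show (m : ℝ) + 1 + 1 - 1 = m + 1 by ring]
      simp only [pow_succ]
      field_simp
    · have := Gamma_pos_of_pos (half_pos hn)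
      positivity
  · rw [Set.indicator_of_notMem (by simpa using hr2), sphereSelfConvProfile,
      if_neg (fun h => hr2 h.2)]
    simp

theorem sphereSelfConv_eq_withDensity {d : ℕ} (hd : 2 ≤ d) :
    sphereSelfConv d = (volume : Measure (EuclideanSpace ℝ (Fin d))).withDensity
      fun x => ENNReal.ofReal (sphereSelfConvProfile d ‖x‖) := by
  obtain ⟨n, rfl⟩ : ∃ n, d = n + 1 := ⟨d - 1, by omega⟩
  have : NeZero n := ⟨by omega⟩
  have hprof := measurable_sphereSelfConvProfile (n + 1)
  set ν := (volume : Measure (EuclideanSpace ℝ (Fin (n + 1)))).withDensity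
    fun x => ENNReal.ofReal (sphereSelfConvProfile (n + 1) ‖x‖) with hν
  have hfin : IsFiniteMeasure (sphereSelfConv (n + 1)) := by
    unfold sphereSelfConv; infer_instance
  have hnorm : (sphereSelfConv (n + 1)).map (fun x => ‖x‖) = ν.map (fun x => ‖x‖) := by
    refine Measure.ext_of_lintegral _ fun g hg => ?_
    rw [lintegral_map hg (by fun_prop), lintegral_map hg (by fun_prop),
      lintegral_norm_sphereSelfConv n hg, hν,
      lintegral_withDensity_eq_lintegral_mul _ (by fun_prop) (by fun_prop)]
    rfl
  have : IsFiniteMeasure ν := by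
    refine ⟨?_⟩
    have h := congrArg (fun κ => κ Set.univ) hnorm
    simp only [Measure.map_apply continuous_norm.measurable MeasurableSet.univ,
      Set.preimage_univ] at h
    rw [← h]
    exact measure_lt_top _ _
  refine Measure.ext_of_map_norm (fun L => ?_) (fun L => ?_) hnorm
  · have hL : Measurable L := L.continuous.measurable
    rw [sphereSelfConv]
    refine (Measure.map_conv_addMonoidHom
      (L : EuclideanSpace ℝ (Fin (n + 1)) →+ EuclideanSpace ℝ (Fin (n + 1))) hL).trans ?_
    exact congrArg₂ _ (map_linearIsometryEquiv_map_coe_toSphere L)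
      (map_linearIsometryEquiv_map_coe_toSphere L)
  · have hL : Measurable L := L.continuous.measurable
    refine Measure.ext_of_lintegral _ fun g hg => ?_
    rw [lintegral_map hg hL, hν,
      lintegral_withDensity_eq_lintegral_mul _ (by fun_prop) (by fun_prop),
      lintegral_withDensity_eq_lintegral_mul _ (by fun_prop) (by fun_prop)]
    conv_rhs => rw [← L.measurePreserving.lintegral_comp (by fun_prop)]
    simp

end Convolution

theorem sphere_self_convolution_density {d : ℕ} (hd : 2 ≤ d)
    (σ : Measure (sphere (0 : EuclideanSpace ℝ (Fin d)) 1))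
    (hσ : σ = (volume : Measure (EuclideanSpace ℝ (Fin d))).toSphere)
    (φ : EuclideanSpace ℝ (Fin d) → ℝ)
    (hφ_cont : Continuous φ) (hφ_supp : HasCompactSupport φ) :
    ∫ ω₁ : sphere (0 : EuclideanSpace ℝ (Fin d)) 1,
      ∫ ω₂ : sphere (0 : EuclideanSpace ℝ (Fin d)) 1,
        φ ((ω₁ : EuclideanSpace ℝ (Fin d)) + (ω₂ : EuclideanSpace ℝ (Fin d))) ∂σ ∂σ
      = ∫ x : EuclideanSpace ℝ (Fin d),
          φ x * (if 0 < ‖x‖ ∧ ‖x‖ < 2 then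
            2 ^ ((3 : ℝ) - d) * (2 * π ^ (((d : ℝ) - 1) / 2) / Gamma (((d : ℝ) - 1) / 2))
              * (4 - ‖x‖ ^ 2) ^ (((d : ℝ) - 3) / 2) / ‖x‖
          else 0) := by
  have hprof := measurable_sphereSelfConvProfile d
  have hfin : IsFiniteMeasure (sphereSelfConv d) := by
    unfold sphereSelfConv; infer_instance
  have hint : Integrable φ (sphereSelfConv d) := hφ_cont.integrable_of_hasCompactSupport hφ_supp
  calc
    _ = ∫ x, φ x ∂sphereSelfConv d := by
      rw [sphereSelfConv] at hint ⊢
      rw [integral_conv hint, hσ, integral_map (by fun_prop)]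
      · refine integral_congr_ae (.of_forall fun ω => ?_)
        dsimp only
        rw [integral_map (by fun_prop) (by fun_prop)]
      · exact (hφ_cont.comp
          continuous_add).stronglyMeasurable.integral_prod_right'.aestronglyMeasurable
    _ = ∫ x, φ x * sphereSelfConvProfile d ‖x‖ := by
      rw [sphereSelfConv_eq_withDensity hd, integral_withDensity_eq_integral_toReal_smul
        (by fun_prop) (.of_forall fun _ => ENNReal.ofReal_lt_top)]
      refine integral_congr_ae (.of_forall fun x => ?_)
      simp [ENNReal.toReal_ofReal (sphereSelfConvProfile_nonneg hd _), mul_comm]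
    _ = _ := rfl
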